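/- arXiv:math/0203203 — 6 statements merged into one kernel-verified Lean document; each statement's English description precedes it below -/
import Mathlib

section
/- For any set A ⊆ ℝP^n, under the canonical identification of ((ℝP^n)*)* with ℝP^n, the double dual (A*_p)*_p equals the set of all points a ∈ ℝP^n such that every hyperplane of ℝP^n containing a intersects A; moreover this set is the projective separability hull of A, i.e., the smallest projectively separable subset of ℝP^n containing A. -/
open Module Set Pointwise

noncomputable section

namespace CC

/-- The underlying vector space of `ℝPⁿ`. -/
abbrev Vec (n : ℕ) : Type := Fin (n + 1) → ℝ

/-- Real projective `n`-space `ℝPⁿ = ℙ(ℝ^{n+1})`. -/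
abbrev Pt (n : ℕ) : Type := Projectivization ℝ (Vec n)

/-- The dual projective space `(ℝPⁿ)*`, whose points are the hyperplanes of `ℝPⁿ`. -/
abbrev DPt (n : ℕ) : Type := Projectivization ℝ (Module.Dual ℝ (Vec n))

/-- The quotient topology on a projectivization. -/
instance projTop {K V : Type*} [DivisionRing K] [AddCommGroup V] [Module K V]
    [TopologicalSpace V] : TopologicalSpace (Projectivization K V) :=
  instTopologicalSpaceQuotient

/-- The canonical topology on the dual of `ℝ^{n+1}` (transported through any linear
coordinate system; all bases induce the same topology). -/
instance dualTop (n : ℕ) : TopologicalSpace (Module.Dual ℝ (Vec n)) :=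
  TopologicalSpace.induced (Module.finBasis ℝ (Module.Dual ℝ (Vec n))).equivFun inferInstance

variable {M : Type*} [AddCommGroup M] [Module ℝ M]

/-- The point `x ∈ ℙ(M)` lies on the hyperplane corresponding to the point `π` of the
dual projective space `ℙ(M*)` (i.e. `x` is in the projectivization of the kernel of any
functional representing `π`). -/
def Incident (π : Projectivization ℝ (Module.Dual ℝ M)) (x : Projectivization ℝ M) : Prop :=
  π.rep x.rep = 0

/-- The projectively dual set `S*_p ⊆ P*`: the set of all hyperplanes of `P`
disjoint from `S`. -/
def dualSet (A : Set (Projectivization ℝ M)) : Set (Projectivization ℝ (Module.Dual ℝ M)) :=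
  {π | ∀ x ∈ A, ¬Incident π x}

/-- Projective separability: every point of the complement of `S` lies on a hyperplane
disjoint from `S`. -/
def ProjSeparable (A : Set (Projectivization ℝ M)) : Prop :=
  ∀ x ∉ A, ∃ π : Projectivization ℝ (Module.Dual ℝ M), Incident π x ∧ ∀ y ∈ A, ¬Incident π y

/-- The projective subspace of `ℙ(M)` associated to a linear subspace `W ≤ M`. -/
def projSet (W : Submodule ℝ M) : Set (Projectivization ℝ M) :=
  {x | x.rep ∈ W}

/-- The canonical identification `ℙ(M) → ℙ(M**)` induced by the canonical isomorphism
`M ≃ M**`. -/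
def toDoubleDual [FiniteDimensional ℝ M] :
    Projectivization ℝ M → Projectivization ℝ (Module.Dual ℝ (Module.Dual ℝ M)) :=
  Projectivization.map (Module.evalEquiv ℝ M).toLinearMap (Module.evalEquiv ℝ M).injective

/-- The `L`-dual set `A^⊥_L ⊆ ℙ(M*)` of a set `A ⊆ ℙ(M)` (for `L = ℙ(W)`): the set of
all hyperplanes `π` of `ℙ(M)` meeting every section `A ∩ N` by a projective subspace
`N ⊇ L` with `dim N = dim L + 1`. -/
def LdualSet (W : Submodule ℝ M) (A : Set (Projectivization ℝ M)) :
    Set (Projectivization ℝ (Module.Dual ℝ M)) :=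
  {π | ∀ N : Submodule ℝ M, W ≤ N → finrank ℝ N = finrank ℝ W + 1 →
    ∃ x ∈ A, Incident π x ∧ x.rep ∈ N}

/-- `(A^⊥_L)^⊥_{L*}`, brought back from `ℙ(M**)` to `ℙ(M)` via the canonical
identification `M ≅ M**`. -/
def Lbidual [FiniteDimensional ℝ M] (W : Submodule ℝ M) (A : Set (Projectivization ℝ M)) :
    Set (Projectivization ℝ M) :=
  toDoubleDual ⁻¹' LdualSet W.dualAnnihilator (LdualSet W A)

/-- The image of a set `A ⊆ ℙ(M)` under the projection from the center `ℙ(W)`: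
`y` is in the image iff some point `x ∈ A` not in the center projects to `y`
(i.e. the class of a representing vector of `x` spans the line `y`). -/
def projImage (W : Submodule ℝ M) (A : Set (Projectivization ℝ M)) :
    Set (Projectivization ℝ (M ⧸ W)) :=
  {y | ∃ x ∈ A, x.rep ∉ W ∧ W.mkQ x.rep ∈ y.submodule}

/-- The coordinate, in the affine chart of `ℙ(M)` given by a functional `φ`
(the complement of the hyperplane `ℙ(ker φ)`, identified with `{v | φ v = 1}`),
of a point `x` with `φ x.rep ≠ 0`. -/
def projChart (φ : Module.Dual ℝ M) (x : Projectivization ℝ M) : M :=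
  (φ x.rep)⁻¹ • x.rep

/-- A convex subset of a projective space: a set disjoint from some hyperplane and
convex in the corresponding affine chart. -/
def IsProjConvex (A : Set (Projectivization ℝ M)) : Prop :=
  ∃ φ : Module.Dual ℝ M, φ ≠ 0 ∧ (∀ x ∈ A, φ x.rep ≠ 0) ∧ Convex ℝ (projChart φ '' A)

/-- `L`-convex-concavity of a closed set `A ⊆ ℙ(M)` with respect to the projective
subspace `L = ℙ(W)`: `A` is closed, disjoint from `L`, all sections of `A` by
projective subspaces `N ⊇ L` with `dim N = dim L + 1` are nonempty and convex, and the
complement of the projection of `A` from any center `T ⊂ L` with `dim T = dim L − 1`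
is open and convex. -/
def IsLConvexConcave [TopologicalSpace M] (W : Submodule ℝ M)
    (A : Set (Projectivization ℝ M)) : Prop :=
  IsClosed A ∧ (∀ x ∈ A, x.rep ∉ W) ∧
    (∀ N : Submodule ℝ M, W ≤ N → finrank ℝ N = finrank ℝ W + 1 →
      (A ∩ projSet N).Nonempty ∧ IsProjConvex (A ∩ projSet N)) ∧
    (∀ T : Submodule ℝ M, T ≤ W → finrank ℝ T + 1 = finrank ℝ W →
      IsOpen (projImage T A)ᶜ ∧ IsProjConvex (projImage T A)ᶜ)

/-- The lift of a hyperplane `π` of `ℙ(M)` containing the center `ℙ(Q)` to a hyperplane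
of the quotient projective space `ℙ(M ⧸ Q)`. -/
def liftHyperplane (Q : Submodule ℝ M) (π : Projectivization ℝ (Module.Dual ℝ M))
    (h : ∀ v ∈ Q, π.rep v = 0) : Projectivization ℝ (Module.Dual ℝ (M ⧸ Q)) :=
  Projectivization.mk ℝ (Q.liftQ π.rep fun v hv => LinearMap.mem_ker.mpr (h v hv))
    (fun hz => π.rep_nonzero (by
      have h2 := Submodule.liftQ_mkQ Q π.rep (fun v hv => LinearMap.mem_ker.mpr (h v hv))
      rw [hz] at h2
      simpa using h2.symm))

/-- Affine separability of a set `B`, inside the affine chart of `ℙ(M)` given by a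
functional `φ`: every point of the chart outside `B` lies in a closed half-space of the
chart (cut out by an affine function which is nonconstant on the chart) disjoint
from `B`.  A closed half-space of the chart `{v | φ v = 1}` is cut out by a functional
`g` (nonproportional to `φ`, so that `g` is nonconstant on the chart) via the
scale-invariant condition `g(x)/φ(x) ≥ 0`. -/
def AffSepInChart (φ : Module.Dual ℝ M) (B : Set (Projectivization ℝ M)) : Prop :=
  ∀ y : Projectivization ℝ M, φ y.rep ≠ 0 → y ∉ B →
    ∃ g : Module.Dual ℝ M, (∀ c : ℝ, g ≠ c • φ) ∧ 0 ≤ g y.rep / φ y.rep ∧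
      ∀ z ∈ B, g z.rep / φ z.rep < 0

/-- `A` is coseparable relative to `L = ℙ(W)`: `A` is disjoint from `L`, and for every
hyperplane `L₁` of `L`, the complement of the projection of `A` from the center `L₁`
misses some hyperplane of `ℝPⁿ/L₁` and is affinely separable in the corresponding
affine chart. -/
def Coseparable (W : Submodule ℝ M) (A : Set (Projectivization ℝ M)) : Prop :=
  (∀ x ∈ A, x.rep ∉ W) ∧
    ∀ W₁ : Submodule ℝ M, W₁ ≤ W → finrank ℝ W₁ + 1 = finrank ℝ W →
      ∃ φ : Module.Dual ℝ (M ⧸ W₁), φ ≠ 0 ∧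
        (∀ y ∈ (projImage W₁ A)ᶜ, φ y.rep ≠ 0) ∧
        AffSepInChart φ (projImage W₁ A)ᶜ

/-- A set `S` contained in the projective subspace `N = ℙ(Nsub)`, disjoint from the
hyperplane `L = ℙ(W)` of `N`, is pointed with respect to `Δ ⊆ L` if it has two vertices
`a, b ∈ S` such that a hyperplane `p` of `N` disjoint from `Δ` meets `S` iff it meets
the straight segment joining `a` and `b` in the affine chart `N ∖ L` (the chart being
given by any functional vanishing on `W` and nonzero at `a` and `b`). -/
def PointedWrt (W Nsub : Submodule ℝ M) (Δ S : Set (Projectivization ℝ M)) : Prop :=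
  ∃ a ∈ S, ∃ b ∈ S,
    ∀ P : Submodule ℝ M, P ≤ Nsub → finrank ℝ P + 1 = finrank ℝ Nsub →
      (∀ x ∈ Δ, x.rep ∉ P) →
      ((∃ x ∈ S, x.rep ∈ P) ↔
        ∀ φ : Module.Dual ℝ M, (∀ w ∈ W, φ w = 0) → φ a.rep ≠ 0 → φ b.rep ≠ 0 →
          ∃ t ∈ Icc (0 : ℝ) 1,
            t • ((φ a.rep)⁻¹ • a.rep) + (1 - t) • ((φ b.rep)⁻¹ • b.rep) ∈ P)

/-- The hyperplane `Γ_c` of `ℙ(M)` containing the center `ℙ(W)` and corresponding to the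
point `c` of `ℙ(M ⧸ W)`. -/
def gammaSet (W : Submodule ℝ M) (c : Projectivization ℝ (M ⧸ W)) :
    Set (Projectivization ℝ M) :=
  {x | W.mkQ x.rep ∈ c.submodule}

/-- The surgery `S_{[a,b]}(A)` of a set `A ⊆ ℙ(M)` along the arc `Arc = [a,b]` of the
projective line `ℙ(M ⧸ W)`, computed in the affine chart given by a functional `φ`
whose kernel is the cone of the hyperplane `Γ_c` (for a point `c ∉ Arc`): points
projecting into `Arc` are replaced by the convex hull of `(A ∩ Γ_a) ∪ (A ∩ Γ_b)` taken
in the chart, points projecting outside `Arc` are kept iff they belong to `A`, and the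
result is disjoint from `ℙ(W)`. -/
def surgery (W : Submodule ℝ M) (a b : Projectivization ℝ (M ⧸ W))
    (Arc : Set (Projectivization ℝ (M ⧸ W))) (φ : Module.Dual ℝ M)
    (A : Set (Projectivization ℝ M)) : Set (Projectivization ℝ M) :=
  {x | x.rep ∉ W ∧
    ((∃ y ∈ Arc, W.mkQ x.rep ∈ y.submodule) →
      φ x.rep ≠ 0 ∧
        projChart φ x ∈ convexHull ℝ (projChart φ '' (A ∩ (gammaSet W a ∪ gammaSet W b)))) ∧
    ((¬∃ y ∈ Arc, W.mkQ x.rep ∈ y.submodule) → x ∈ A)}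

/-- The linear map `M* ⧸ T → Q*` (for `Q = ℙ(T)*`-perp, i.e. `Q = T.dualCoannihilator`)
realizing the canonical identification of `(ℝPⁿ)*/T` with the space of hyperplanes of
the projective space `ℙ(Q)`: the class of a hyperplane `π ⊅ Q` of `ℝPⁿ` corresponds to
the hyperplane `π ∩ ℙ(Q)` of `ℙ(Q)`. -/
def restrictToSub (T : Submodule ℝ (Module.Dual ℝ M)) :
    (Module.Dual ℝ M ⧸ T) →ₗ[ℝ] Module.Dual ℝ T.dualCoannihilator :=
  T.liftQ (T.dualCoannihilator.subtype.dualMap)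
    (fun φ hφ => LinearMap.mem_ker.mpr
      (LinearMap.ext fun q => (Submodule.mem_dualCoannihilator _).mp q.2 φ hφ))

theorem incident_toDoubleDual (a : Projectivization ℝ M) [FiniteDimensional ℝ M]
    (π : Projectivization ℝ (Module.Dual ℝ M)) :
    Incident (toDoubleDual a) π ↔ Incident π a := by
  have hne : (Module.evalEquiv ℝ M).toLinearMap a.rep ≠ 0 :=
    (Module.evalEquiv ℝ M).map_ne_zero_iff.2 a.rep_nonzero
  have h1 : toDoubleDual a = Projectivization.mk ℝ _ hne := by
    conv_lhs => rw [← a.mk_rep]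
    rfl
  obtain ⟨u, hu⟩ := Projectivization.exists_smul_eq_mk_rep ℝ _ hne
  unfold Incident
  rw [h1, ← hu]
  simp [Units.smul_def]

/-- For any `A ⊆ ℝPⁿ`, under the canonical identification of `(ℝPⁿ)**`
with `ℝPⁿ`, the double dual `(A*_p)*_p` is the set of points `a` such that every
hyperplane through `a` meets `A`; moreover it is the projective separability hull of
`A`: the smallest projectively separable set containing `A`. -/
theorem statement1 (n : ℕ) (A : Set (Pt n)) :
    toDoubleDual ⁻¹' dualSet (dualSet A) =
      {a : Pt n | ∀ π : DPt n, Incident π a → ∃ x ∈ A, Incident π x} ∧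
    ProjSeparable (toDoubleDual ⁻¹' dualSet (dualSet A)) ∧
    A ⊆ toDoubleDual ⁻¹' dualSet (dualSet A) ∧
    (∀ T : Set (Pt n), ProjSeparable T → A ⊆ T →
      toDoubleDual ⁻¹' dualSet (dualSet A) ⊆ T) := by
  have key : ∀ a : Pt n, a ∈ toDoubleDual ⁻¹' dualSet (dualSet A) ↔
      ∀ π : DPt n, Incident π a → ∃ x ∈ A, Incident π x := by
    intro a
    simp only [mem_preimage]
    constructor
    · intro h π hπ
      by_contra hc
      push Not at hc
      exact h π hc ((incident_toDoubleDual a π).2 hπ)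
    · intro h π hπ hi
      obtain ⟨x, hx, hx'⟩ := h π ((incident_toDoubleDual a π).1 hi)
      exact hπ x hx hx'
  refine ⟨Set.ext key, ?_, ?_, ?_⟩
  · intro x hx
    rw [key] at hx
    push Not at hx
    obtain ⟨π, h1, h2⟩ := hx
    refine ⟨π, h1, fun y hy hi => ?_⟩
    obtain ⟨z, hz, hz'⟩ := (key y).1 hy π hi
    exact h2 z hz hz'
  · intro a ha
    exact (key a).2 fun π h => ⟨a, ha, h⟩
  · intro T hT hAT a ha
    by_contra hc
    obtain ⟨π, h1, h2⟩ := hT a hc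
    obtain ⟨x, hx, hx'⟩ := (key a).1 ha π h1
    exact h2 x (hAT hx) hx'
end CC
end
end

section
/- Let L and M be projective subspaces of ℝP^n with M ∩ L = ∅ and dim M = n − dim L − 1. Then M^⊥_L = M*, the set of all hyperplanes of ℝP^n containing M. -/
open Module Set Pointwise

noncomputable section

namespace CC

variable {M : Type*} [AddCommGroup M] [Module ℝ M]

/-- If `M = ℙ(U)` and `L = ℙ(W)` are disjoint projective subspaces of
`ℝPⁿ` with `dim M = n − dim L − 1`, then `M^⊥_L = M*`, the set of all hyperplanes of
`ℝPⁿ` containing `M`. -/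
theorem statement4 (n : ℕ) (W U : Submodule ℝ (Vec n)) (hW : W ≠ ⊥) (hU : U ≠ ⊥)
    (hdisj : U ⊓ W = ⊥) (hdim : finrank ℝ U + finrank ℝ W = n + 1) :
    LdualSet W (projSet U) = {π : DPt n | ∀ x ∈ projSet U, Incident π x} := by
  have key : ∀ v : Vec n, v ∈ U → v ∈ W → v = 0 := fun v h1 h2 => by
    have : v ∈ U ⊓ W := ⟨h1, h2⟩
    rw [hdisj] at this
    simpa using this
  ext π
  simp only [LdualSet, projSet, Incident, Set.mem_setOf_eq]
  constructor
  · intro h x hx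
    have hx0 := x.rep_nonzero
    have hinf : W ⊓ Submodule.span ℝ {x.rep} = ⊥ := by
      rw [eq_bot_iff]
      rintro v ⟨h1, h2⟩
      have h3 : v ∈ U := (Submodule.span_singleton_le_iff_mem _ _).2 hx h2
      simpa using key v h3 h1
    have hf := Submodule.finrank_sup_add_finrank_inf_eq W (Submodule.span ℝ {x.rep})
    rw [hinf, finrank_bot, finrank_span_singleton hx0, add_zero] at hf
    obtain ⟨y, hyU, hy, hyN⟩ := h _ le_sup_left hf
    obtain ⟨w, hw, z, hz, hwz⟩ := Submodule.mem_sup.1 hyN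
    obtain ⟨c, rfl⟩ := Submodule.mem_span_singleton.1 hz
    have hwU : w ∈ U := by
      have : w = y.rep - c • x.rep := by rw [← hwz]; abel
      rw [this]
      exact U.sub_mem hyU (U.smul_mem c hx)
    rw [key w hwU hw, zero_add] at hwz
    rw [← hwz, map_smul, smul_eq_mul] at hy
    rcases mul_eq_zero.1 hy with hc | hc
    · exact absurd (by rw [← hwz, hc, zero_smul]) y.rep_nonzero
    · exact hc
  · intro h N hWN hN
    have hne : U ⊓ N ≠ ⊥ := by
      intro hb
      have hf := Submodule.finrank_sup_add_finrank_inf_eq U N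
      have hle := Submodule.finrank_le (U ⊔ N)
      rw [hb, finrank_bot] at hf
      rw [Module.finrank_fin_fun] at hle
      omega
    obtain ⟨v, ⟨hvU, hvN⟩, hv0⟩ := Submodule.exists_mem_ne_zero_of_ne_bot hne
    obtain ⟨a, ha⟩ := Projectivization.exists_smul_eq_mk_rep ℝ v hv0
    have hr : (Projectivization.mk ℝ v hv0).rep = (a : ℝ) • v := ha.symm
    have hm : (Projectivization.mk ℝ v hv0).rep ∈ U := by
      rw [hr]; exact U.smul_mem _ hvU
    refine ⟨Projectivization.mk ℝ v hv0, hm, h _ hm, ?_⟩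
    rw [hr]; exact N.smul_mem _ hvN

end CC
end
end

section
/- Let L ⊆ ℝP^n be a projective subspace and A ⊆ ℝP^n a set with A ∩ L = ∅. Let N ⊆ (ℝP^n)* be a projective subspace containing L* as a hyperplane (L* ⊆ N and dim N = dim L* + 1); then the dual subspace N* ⊆ ℝP^n satisfies N* ⊆ L and dim N* = dim L − 1. Every point of N is a hyperplane of ℝP^n containing N*, whose image under the projection from center N* is a hyperplane of ℝP^n/N*; this defines a bijection between N and the set of hyperplanes of ℝP^n/N*, i.e., the points of (ℝP^n/N*)*. Under this bijection, the section A^⊥_L ∩ N corresponds to B*_p, where B is the complement in ℝP^n/N* of the image of A under the projection from center N*, and B*_p is the projectively dual set of B taken in the projective space ℝP^n/N*. -/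
open Module Set Pointwise

noncomputable section

namespace CC

variable {M : Type*} [AddCommGroup M] [Module ℝ M]

theorem incident_mk_iff (φ : Module.Dual ℝ M) (hφ : φ ≠ 0) (v : M) (hv : v ≠ 0) :
    Incident (Projectivization.mk ℝ φ hφ) (Projectivization.mk ℝ v hv) ↔ φ v = 0 := by
  obtain ⟨a, ha⟩ := Projectivization.exists_smul_eq_mk_rep ℝ φ hφ
  obtain ⟨b, hb⟩ := Projectivization.exists_smul_eq_mk_rep ℝ v hv
  unfold Incident
  rw [← ha, ← hb]
  simp [Units.smul_def]

/-- A point of `ℙ(M ⧸ Q)` that is the class of `v`, on the lift of `π`. -/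
theorem incident_lift_iff (Q : Submodule ℝ M) (π : Projectivization ℝ (Module.Dual ℝ M))
    (h : ∀ v ∈ Q, π.rep v = 0) (v : M) (hv : Q.mkQ v ≠ 0) :
    Incident (liftHyperplane Q π h) (Projectivization.mk ℝ (Q.mkQ v) hv) ↔ π.rep v = 0 := by
  unfold liftHyperplane
  rw [incident_mk_iff]
  simp

theorem mem_projImage_mk_iff (Q : Submodule ℝ M) (A : Set (Projectivization ℝ M))
    (v : M) (hv : Q.mkQ v ≠ 0) :
    Projectivization.mk ℝ (Q.mkQ v) hv ∈ projImage Q A ↔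
      ∃ x ∈ A, x.rep ∉ Q ∧ ∃ c : ℝ, x.rep - c • v ∈ Q := by
  unfold projImage
  simp only [Set.mem_ofPred_eq, Projectivization.submodule_mk, Submodule.mem_span_singleton]
  refine exists_congr fun x => and_congr_right fun _ => and_congr_right fun _ =>
    exists_congr fun c => ?_
  rw [← map_smul, eq_comm, ← sub_eq_zero, ← map_sub, ← LinearMap.mem_ker, Submodule.ker_mkQ]

theorem section_iff [FiniteDimensional ℝ M] (W Q : Submodule ℝ M)
    (A : Set (Projectivization ℝ M)) (hAL : ∀ x ∈ A, x.rep ∉ W) (hQW : Q ≤ W)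
    (hdim : finrank ℝ Q + 1 = finrank ℝ W) (π : Projectivization ℝ (Module.Dual ℝ M))
    (h : ∀ v ∈ Q, π.rep v = 0) :
    π ∈ LdualSet W A ↔ liftHyperplane Q π h ∈ dualSet ((projImage Q A)ᶜ) := by
  have hne : ∀ v, v ∉ Q → Q.mkQ v ≠ 0 := by
    intro v hv h0
    rw [← LinearMap.mem_ker, Submodule.ker_mkQ] at h0
    exact hv h0
  have hker : (¬ ∀ w ∈ W, π.rep w = 0) → ∀ w ∈ W, π.rep w = 0 → w ∈ Q := by
    intro hn w hw hw0
    have h1 : Q ≤ W ⊓ LinearMap.ker π.rep := le_inf hQW h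
    have h2 : W ⊓ LinearMap.ker π.rep < W := by
      refine lt_of_le_of_ne inf_le_left fun he => hn fun u hu => ?_
      rw [← he] at hu
      exact hu.2
    have h3 := Submodule.finrank_lt_finrank_of_lt h2
    have h4 : Q = W ⊓ LinearMap.ker π.rep :=
      Submodule.eq_of_le_of_finrank_le h1 (by omega)
    rw [h4]
    exact ⟨hw, hw0⟩
  have hfin : ∀ v, v ∉ W → finrank ℝ ↥(W ⊔ Submodule.span ℝ {v}) = finrank ℝ W + 1 := by
    intro v hv
    have hv0 : v ≠ 0 := fun h0 => hv (h0 ▸ W.zero_mem)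
    have h1 := Submodule.finrank_sup_add_finrank_inf_eq W (Submodule.span ℝ {v})
    have h2 : W ⊓ Submodule.span ℝ {v} = ⊥ :=
      ((Submodule.disjoint_span_singleton' hv0).mpr hv).eq_bot
    rw [h2, finrank_bot, finrank_span_singleton hv0] at h1
    exact h1
  constructor
  · intro hπ y hy hinc
    have hn : ¬ ∀ w ∈ W, π.rep w = 0 := by
      intro hall
      obtain ⟨u, hu⟩ : ∃ u, π.rep u ≠ 0 := by
        by_contra! hc
        exact π.rep_nonzero (LinearMap.ext hc)
      obtain ⟨x, hxA, hx0, hxN⟩ := hπ (W ⊔ Submodule.span ℝ {u}) le_sup_left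
        (hfin u fun huW => hu (hall u huW))
      obtain ⟨w, hw, z, hz, hx⟩ := Submodule.mem_sup.mp hxN
      obtain ⟨c, rfl⟩ := Submodule.mem_span_singleton.mp hz
      unfold Incident at hx0
      rw [← hx, map_add, hall w hw, zero_add, map_smul, smul_eq_mul] at hx0
      have hc : c = 0 := (mul_eq_zero.mp hx0).resolve_right hu
      apply hAL x hxA
      rw [← hx, hc]
      simpa using hw
    induction y using Projectivization.ind with
    | h v' hv' =>
    obtain ⟨v, rfl⟩ := Q.mkQ_surjective v'
    rw [incident_lift_iff] at hinc
    have hvQ : v ∉ Q := fun hq => hv' (by rwa [← LinearMap.mem_ker, Submodule.ker_mkQ])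
    have hvW : v ∉ W := fun hw => hvQ (hker hn v hw hinc)
    apply hy
    rw [mem_projImage_mk_iff]
    obtain ⟨x, hxA, hx0, hxN⟩ := hπ (W ⊔ Submodule.span ℝ {v}) le_sup_left (hfin v hvW)
    obtain ⟨w, hw, z, hz, hx⟩ := Submodule.mem_sup.mp hxN
    obtain ⟨c, rfl⟩ := Submodule.mem_span_singleton.mp hz
    unfold Incident at hx0
    rw [← hx, map_add, map_smul, hinc, smul_zero, add_zero] at hx0
    refine ⟨x, hxA, fun hq => hAL x hxA (hQW hq), c, ?_⟩
    rw [← hx, add_sub_cancel_right]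
    exact hker hn w hw hx0
  · intro hd N hWN hN
    have key : ∀ v, v ∉ Q → π.rep v = 0 → ∃ x ∈ A, ∃ c : ℝ, x.rep - c • v ∈ Q := by
      intro v hv hv0
      by_contra hcon
      refine hd (Projectivization.mk ℝ (Q.mkQ v) (hne v hv)) ?_
        ((incident_lift_iff Q π h v (hne v hv)).mpr hv0)
      intro hmem
      obtain ⟨x, hxA, -, c, hc⟩ := (mem_projImage_mk_iff Q A v (hne v hv)).mp hmem
      exact hcon ⟨x, hxA, c, hc⟩
    have hn : ¬ ∀ w ∈ W, π.rep w = 0 := by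
      intro hall
      obtain ⟨w, hw, hwQ⟩ : ∃ w ∈ W, w ∉ Q := by
        by_contra! hc
        have := Submodule.finrank_mono (show W ≤ Q from hc)
        omega
      obtain ⟨x, hxA, c, hc⟩ := key w hwQ (hall w hw)
      apply hAL x hxA
      have := W.add_mem (hQW hc) (W.smul_mem c hw)
      rwa [sub_add_cancel] at this
    obtain ⟨v, hv, hvW⟩ : ∃ v ∈ N, v ∉ W := by
      by_contra! hc
      have := Submodule.finrank_mono (show N ≤ W from hc)
      omega
    push Not at hn
    obtain ⟨w, hw, hw0⟩ := hn
    set u := v - (π.rep v / π.rep w) • w with hu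
    have huW : u ∉ W := fun huW => hvW (by
      have := W.add_mem huW (W.smul_mem (π.rep v / π.rep w) hw)
      rwa [hu, sub_add_cancel] at this)
    have huN : u ∈ N := N.sub_mem hv (N.smul_mem _ (hWN hw))
    have hu0 : π.rep u = 0 := by
      rw [hu, map_sub, map_smul, smul_eq_mul, div_mul_cancel₀ _ hw0, sub_self]
    obtain ⟨x, hxA, c, hc⟩ := key u (fun hq => huW (hQW hq)) hu0
    refine ⟨x, hxA, ?_, ?_⟩
    · have := h _ hc
      rw [map_sub, map_smul, hu0, smul_zero, sub_zero] at this
      exact this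
    · have := N.add_mem (hWN (hQW hc)) (N.smul_mem c huN)
      rwa [sub_add_cancel] at this

/-- Let `A ⊆ ℝPⁿ` be disjoint from `L = ℙ(W)` and let `N = ℙ(S)` be a
projective subspace of `(ℝPⁿ)*` containing `L*` as a hyperplane.  Then
`N* = ℙ(S.dualCoannihilator)` satisfies `N* ⊆ L` and `dim N* = dim L − 1`; every point
of `N` is a hyperplane of `ℝPⁿ` containing `N*`, and projecting such hyperplanes from
the center `N*` gives a bijection from `N` onto the hyperplanes of `ℝPⁿ/N*` under
which the section `A^⊥_L ∩ N` corresponds to `B*_p`, where `B` is the complement of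
the projection of `A` from the center `N*`. -/
theorem statement5 (n : ℕ) (W : Submodule ℝ (Vec n)) (hW : W ≠ ⊥) (A : Set (Pt n))
    (hAL : ∀ x ∈ A, x.rep ∉ W)
    (S : Submodule ℝ (Module.Dual ℝ (Vec n)))
    (hS1 : W.dualAnnihilator ≤ S)
    (hS2 : finrank ℝ S = finrank ℝ W.dualAnnihilator + 1) :
    S.dualCoannihilator ≤ W ∧
    finrank ℝ S.dualCoannihilator + 1 = finrank ℝ W ∧
    (∀ π : DPt n, π.rep ∈ S → ∀ v ∈ S.dualCoannihilator, π.rep v = 0) ∧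
    Function.Bijective
      (fun π : {π : DPt n // π.rep ∈ S} =>
        liftHyperplane S.dualCoannihilator π.1
          (fun v hv => (Submodule.mem_dualCoannihilator _).mp hv π.1.rep π.2)) ∧
    (∀ π : DPt n, ∀ h : π.rep ∈ S,
      (π ∈ LdualSet W A ↔
        liftHyperplane S.dualCoannihilator π
            (fun v hv => (Submodule.mem_dualCoannihilator _).mp hv π.rep h) ∈
          dualSet ((projImage S.dualCoannihilator A)ᶜ))) := by
  have hQW : S.dualCoannihilator ≤ W := by
    have := Submodule.dualCoannihilator_anti hS1
    rwa [Subspace.dualAnnihilator_dualCoannihilator_eq] at this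
  have hdim : finrank ℝ S.dualCoannihilator + 1 = finrank ℝ W := by
    have h1 := Subspace.finrank_add_finrank_dualCoannihilator_eq S
    have h2 := Subspace.finrank_add_finrank_dualAnnihilator_eq W
    omega
  refine ⟨hQW, hdim, fun π hπ v hv => (Submodule.mem_dualCoannihilator _).mp hv π.rep hπ,
    ⟨?_, ?_⟩, fun π h => section_iff W _ A hAL hQW hdim π _⟩
  · rintro ⟨π, hπ⟩ ⟨ρ, hρ⟩ heq
    simp only [liftHyperplane] at heq
    rw [Projectivization.mk_eq_mk_iff] at heq
    obtain ⟨a, ha⟩ := heq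
    apply Subtype.ext
    show π = ρ
    rw [← π.mk_rep, ← ρ.mk_rep, Projectivization.mk_eq_mk_iff]
    refine ⟨a, LinearMap.ext fun v => ?_⟩
    have := LinearMap.congr_fun ha (S.dualCoannihilator.mkQ v)
    simpa [Units.smul_def] using this
  · intro ψ
    induction ψ using Projectivization.ind with
    | h ψ hψ =>
    have hφ : ψ.comp S.dualCoannihilator.mkQ ≠ 0 := by
      intro h0
      apply hψ
      refine LinearMap.ext fun y => ?_
      obtain ⟨v, rfl⟩ := S.dualCoannihilator.mkQ_surjective y
      exact LinearMap.congr_fun h0 v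
    have hφS : ψ.comp S.dualCoannihilator.mkQ ∈ S := by
      refine (Subspace.dualCoannihilator_dualAnnihilator_eq (W := S)).le ?_
      rw [Submodule.mem_dualAnnihilator]
      intro w hw
      rw [← Submodule.ker_mkQ S.dualCoannihilator, LinearMap.mem_ker] at hw
      rw [LinearMap.comp_apply, hw, map_zero]
    obtain ⟨a, ha⟩ := Projectivization.exists_smul_eq_mk_rep ℝ _ hφ
    refine ⟨⟨Projectivization.mk ℝ _ hφ, ?_⟩, ?_⟩
    · rw [← ha]
      exact S.smul_mem _ hφS
    · simp only [liftHyperplane]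
      rw [Projectivization.mk_eq_mk_iff]
      refine ⟨a, ?_⟩
      refine LinearMap.ext fun y => ?_
      obtain ⟨v, rfl⟩ := S.dualCoannihilator.mkQ_surjective y
      have := LinearMap.congr_fun ha v
      simpa [Units.smul_def] using this

end CC
end
end

section
/- Let L ⊆ ℝP^n be a projective subspace and let A ⊆ ℝP^n be coseparable relative to L. Let T ⊆ L* be a projective subspace with dim T = dim L* − 1 (a hyperplane of L*), and let Q := T* ⊆ ℝP^n, so that L ⊆ Q and dim Q = dim L + 1. The quotient (ℝP^n)*/T is canonically identified with Q*, the space of hyperplanes of the projective space Q (a hyperplane π of ℝP^n not containing Q corresponds to the hyperplane π ∩ Q of Q). Then A^⊥_L ∩ T = ∅, and under this identification the complement of the image of A^⊥_L under the projection from center T equals (A ∩ Q)*_p, the projectively dual set of A ∩ Q taken in the projective space Q. -/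
open Module Set Pointwise

noncomputable section

namespace CC

variable {M : Type*} [AddCommGroup M] [Module ℝ M]

theorem rep_mk_zero_iff {V : Type*} [AddCommGroup V] [Module ℝ V] (v : V) (hv : v ≠ 0)
    (g : V →ₗ[ℝ] ℝ) : g (Projectivization.mk ℝ v hv).rep = 0 ↔ g v = 0 := by
  obtain ⟨a, ha⟩ := Projectivization.exists_smul_eq_mk_rep ℝ v hv
  rw [← ha, Units.smul_def, map_smul, smul_eq_mul]
  simp

theorem mk_rep_apply_zero_iff {V : Type*} [AddCommGroup V] [Module ℝ V] (H : Module.Dual ℝ V)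
    (hH : H ≠ 0) (v : V) : (Projectivization.mk ℝ H hH).rep v = 0 ↔ H v = 0 :=
  rep_mk_zero_iff H hH (LinearMap.applyₗ v)

/-- Separation step: a functional vanishing at a given point of the image and at no point of
the complement of the image. -/
theorem exists_sep {V : Type*} [AddCommGroup V] [Module ℝ V] (φ : Module.Dual ℝ V)
    (B : Set (Projectivization ℝ V)) (h1 : ∀ y ∈ B, φ y.rep ≠ 0) (h2 : AffSepInChart φ B)
    (p : Projectivization ℝ V) (hp : p ∉ B) :
    ∃ h : Module.Dual ℝ V, h p.rep = 0 ∧ ∀ y ∈ B, h y.rep ≠ 0 := by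
  by_cases h0 : φ p.rep = 0
  · exact ⟨φ, h0, h1⟩
  · obtain ⟨g, -, hg, hB⟩ := h2 p h0 hp
    refine ⟨g - (g p.rep / φ p.rep) • φ, ?_, ?_⟩
    · simp [div_mul_cancel₀ _ h0]
    · intro y hy h
      have h3 := hB y hy
      have h4 : g y.rep = g p.rep / φ p.rep * φ y.rep := by
        simpa [sub_eq_zero] using h
      rw [h4, mul_div_assoc, div_self (h1 y hy), mul_one] at h3
      linarith

theorem finrank_inf_ker {V : Type*} [AddCommGroup V] [Module ℝ V] [FiniteDimensional ℝ V]
    (W : Submodule ℝ V) (f : Module.Dual ℝ V) (w : V) (hw : w ∈ W) (hf : f w ≠ 0) :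
    finrank ℝ (W ⊓ LinearMap.ker f : Submodule ℝ V) + 1 = finrank ℝ W := by
  have h := (f.domRestrict W).finrank_range_add_finrank_ker
  have hs : Function.Surjective (f.domRestrict W) :=
    LinearMap.surjective (fun h0 => hf (by simpa using LinearMap.congr_fun h0 ⟨w, hw⟩))
  rw [LinearMap.range_eq_top.mpr hs, finrank_top, Module.finrank_self] at h
  have h2 : W ⊓ LinearMap.ker f = (LinearMap.ker (f.domRestrict W)).map W.subtype := by
    ext x
    simp [and_comm]
  rw [h2, Submodule.finrank_map_subtype_eq]
  omega

theorem mem_sup_of_finrank {V : Type*} [AddCommGroup V] [Module ℝ V] [FiniteDimensional ℝ V]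
    (W Q : Submodule ℝ V) (hWQ : W ≤ Q) (hd : finrank ℝ Q = finrank ℝ W + 1) (a : V)
    (ha : a ∈ Q) (haW : a ∉ W) (q : V) (hq : q ∈ Q) : ∃ w ∈ W, ∃ c : ℝ, q = w + c • a := by
  have hlt : W < W ⊔ Submodule.span ℝ {a} := by
    refine lt_of_le_of_ne le_sup_left fun h => haW ?_
    rw [h]
    exact Submodule.mem_sup_right (Submodule.mem_span_singleton_self a)
  have h1 := Submodule.finrank_lt_finrank_of_lt hlt
  have h2 : W ⊔ Submodule.span ℝ {a} = Q :=
    Submodule.eq_of_le_of_finrank_le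
      (sup_le hWQ (by simpa [Submodule.span_singleton_le_iff_mem] using ha)) (by omega)
  rw [← h2, Submodule.mem_sup] at hq
  obtain ⟨w, hw, u, hu, rfl⟩ := hq
  obtain ⟨c, rfl⟩ := Submodule.mem_span_singleton.mp hu
  exact ⟨w, hw, c, rfl⟩

/-- The main construction. -/
theorem exists_hyper {V : Type*} [AddCommGroup V] [Module ℝ V] [FiniteDimensional ℝ V]
    (W : Submodule ℝ V) (A : Set (Projectivization ℝ V)) (hA : Coseparable W A)
    (f : Module.Dual ℝ V) (w : V) (hw : w ∈ W) (hf : f w ≠ 0) (a : Projectivization ℝ V)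
    (ha : a ∈ A) :
    ∃ H : Module.Dual ℝ V, ∃ hH : H ≠ 0, H w ≠ 0 ∧ (∀ v ∈ W, f v = 0 → H v = 0) ∧ H a.rep = 0 ∧
      Projectivization.mk ℝ H hH ∈ LdualSet W A := by
  obtain ⟨hAW, hA⟩ := hA
  obtain ⟨W₁, hW₁⟩ : ∃ W₁, W₁ = W ⊓ LinearMap.ker f := ⟨_, rfl⟩
  have hle : W₁ ≤ W := hW₁ ▸ inf_le_left
  obtain ⟨φ, -, h1, h2⟩ := hA W₁ hle (hW₁ ▸ finrank_inf_ker W f w hw hf)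
  have hnz : ∀ v, v ∉ W₁ → W₁.mkQ v ≠ 0 := fun v hv h => hv (by simpa using h)
  have haW₁ : a.rep ∉ W₁ := fun h => hAW a ha (hle h)
  obtain ⟨h, hp, hB⟩ := exists_sep φ _ h1 h2 (Projectivization.mk ℝ _ (hnz _ haW₁))
    (by
      intro hc
      refine hc ⟨a, ha, haW₁, ?_⟩
      rw [Projectivization.submodule_mk]
      exact Submodule.mem_span_singleton_self _)
  have key : ∀ v, v ∉ W₁ → h (W₁.mkQ v) = 0 →
      ∃ x ∈ A, ∃ c : ℝ, x.rep - c • v ∈ W₁ := by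
    intro v hv hv0
    by_contra hcon
    refine hB (Projectivization.mk ℝ _ (hnz v hv)) ?_ ((rep_mk_zero_iff _ _ h).mpr hv0)
    rintro ⟨x, hx, -, hxs⟩
    rw [Projectivization.submodule_mk] at hxs
    obtain ⟨c, hc⟩ := Submodule.mem_span_singleton.mp hxs
    refine hcon ⟨x, hx, c, ?_⟩
    rw [← map_smul] at hc
    exact (Submodule.Quotient.eq W₁).mp hc.symm
  have hHW₁ : ∀ v ∈ W₁, h (W₁.mkQ v) = 0 := by
    intro v hv
    have : W₁.mkQ v = 0 := by simpa using hv
    rw [this, map_zero]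
  have hw₁ : w ∉ W₁ := by
    intro hc
    rw [hW₁] at hc
    exact hf hc.2
  have hHw : h (W₁.mkQ w) ≠ 0 := by
    intro h0
    obtain ⟨x, hx, c, hc⟩ := key w hw₁ h0
    refine hAW x hx ?_
    have := W.add_mem (hle hc) (W.smul_mem c hw)
    simpa using this
  refine ⟨h ∘ₗ W₁.mkQ, fun h0 => hHw (by simpa using LinearMap.congr_fun h0 w), hHw, ?_, ?_, ?_⟩
  · intro v hv hfv
    exact hHW₁ v (hW₁ ▸ ⟨hv, hfv⟩)
  · exact (rep_mk_zero_iff _ _ h).mp hp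
  · intro N hWN hN
    obtain ⟨u, huN, huW⟩ : ∃ u ∈ N, u ∉ W := by
      by_contra! hcon
      have := Submodule.finrank_mono (show N ≤ W from hcon)
      omega
    obtain ⟨v, hv⟩ : ∃ v, v = h (W₁.mkQ w) • u - h (W₁.mkQ u) • w := ⟨_, rfl⟩
    have hvN : v ∈ N := hv ▸ N.sub_mem (N.smul_mem _ huN) (N.smul_mem _ (hWN hw))
    have hvW : v ∉ W := by
      intro hvW
      apply huW
      have h5 := W.add_mem hvW (W.smul_mem (h (W₁.mkQ u)) hw)
      rw [hv, sub_add_cancel] at h5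
      exact (W.smul_mem_iff hHw).mp h5
    have hv0 : h (W₁.mkQ v) = 0 := by
      rw [hv, map_sub, map_sub, map_smul, map_smul, map_smul, map_smul, smul_eq_mul, smul_eq_mul,
        mul_comm, sub_self]
    obtain ⟨x, hx, c, hc⟩ := key v (fun hh => hvW (hle hh)) hv0
    refine ⟨x, hx, ?_, ?_⟩
    · rw [Incident, mk_rep_apply_zero_iff]
      have := hHW₁ _ hc
      rw [map_sub, map_sub, map_smul, map_smul, hv0, smul_zero, sub_zero] at this
      exact this
    · have := N.add_mem (hWN (hle hc)) (N.smul_mem c hvN)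
      simpa using this

/-- Let `A ⊆ ℝPⁿ` be coseparable relative to `L = ℙ(W)` and let
`T = ℙ(Tsub)` be a hyperplane of `L*`, with `Q = T* = ℙ(Tsub.dualCoannihilator)`, so
that `L ⊆ Q` and `dim Q = dim L + 1`.  Then `A^⊥_L ∩ T = ∅`; the canonical map
`(ℝPⁿ)*/T → Q*` (sending the class of a hyperplane `π ⊅ Q` to the hyperplane `π ∩ Q`
of `Q`) is a linear isomorphism; and under the induced identification the complement
of the projection of `A^⊥_L` from the center `T` equals `(A ∩ Q)*_p`, the projective
dual of `A ∩ Q` computed in the projective space `Q`. -/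
theorem statement6 (n : ℕ) (W : Submodule ℝ (Vec n)) (hW : W ≠ ⊥) (A : Set (Pt n))
    (hA : Coseparable W A)
    (Tsub : Submodule ℝ (Module.Dual ℝ (Vec n)))
    (hT1 : Tsub ≤ W.dualAnnihilator)
    (hT2 : finrank ℝ Tsub + 1 = finrank ℝ W.dualAnnihilator) :
    W ≤ Tsub.dualCoannihilator ∧
    finrank ℝ Tsub.dualCoannihilator = finrank ℝ W + 1 ∧
    (∀ π ∈ LdualSet W A, π.rep ∉ Tsub) ∧
    Function.Bijective (restrictToSub (M := Vec n) Tsub) ∧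
    (∀ y : Projectivization ℝ (Module.Dual ℝ (Vec n) ⧸ Tsub),
      ∀ z : Projectivization ℝ (Module.Dual ℝ Tsub.dualCoannihilator),
        restrictToSub Tsub y.rep ∈ z.submodule →
          (y ∈ (projImage Tsub (LdualSet W A))ᶜ ↔
            z ∈ dualSet {x : Projectivization ℝ Tsub.dualCoannihilator |
              Projectivization.map Tsub.dualCoannihilator.subtype
                (Submodule.injective_subtype _) x ∈ A})) := by
  have hWQ : W ≤ Tsub.dualCoannihilator := by
    intro w hw
    rw [Submodule.mem_dualCoannihilator]
    intro φ hφ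
    exact (Submodule.mem_dualAnnihilator φ).mp (hT1 hφ) w hw
  have hdim : finrank ℝ Tsub.dualCoannihilator = finrank ℝ W + 1 := by
    have h1 := Subspace.finrank_add_finrank_dualCoannihilator_eq Tsub
    have h2 := Subspace.finrank_add_finrank_dualAnnihilator_eq W
    omega
  have hmemT : ∀ f : Module.Dual ℝ (Vec n), (∀ q ∈ Tsub.dualCoannihilator, f q = 0) → f ∈ Tsub := by
    intro f hf
    rw [← Subspace.dualCoannihilator_dualAnnihilator_eq (W := Tsub)]
    exact (Submodule.mem_dualAnnihilator f).mpr hf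
  have hthird : ∀ π ∈ LdualSet W A, π.rep ∉ Tsub := by
    intro π hπ hT
    have hπW : ∀ w ∈ W, π.rep w = 0 := (Submodule.mem_dualAnnihilator _).mp (hT1 hT)
    obtain ⟨u, hu⟩ : ∃ u, π.rep u ≠ 0 := by
      by_contra! hcon
      exact π.rep_nonzero (LinearMap.ext hcon)
    have huW : u ∉ W := fun h => hu (hπW u h)
    have hfr : finrank ℝ (W ⊔ Submodule.span ℝ {u} : Submodule ℝ (Vec n)) = finrank ℝ W + 1 := by
      have h1 := Submodule.finrank_add_le_finrank_add_finrank W (Submodule.span ℝ {u})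
      have h2 := finrank_span_singleton (K := ℝ) (v := u) (fun h => huW (h ▸ W.zero_mem))
      have hlt : W < W ⊔ Submodule.span ℝ {u} := by
        refine lt_of_le_of_ne le_sup_left fun h => huW ?_
        rw [h]
        exact Submodule.mem_sup_right (Submodule.mem_span_singleton_self u)
      have h3 := Submodule.finrank_lt_finrank_of_lt hlt
      omega
    obtain ⟨x, hx, hinc, hxN⟩ := hπ _ le_sup_left hfr
    obtain ⟨w, hw, c, hc⟩ := mem_sup_of_finrank W _ le_sup_left hfr u
      (Submodule.mem_sup_right (Submodule.mem_span_singleton_self u)) huW _ hxN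
    rw [Incident, hc, map_add, map_smul, hπW w hw, zero_add, smul_eq_mul] at hinc
    have hc0 : c = 0 := (mul_eq_zero.mp hinc).resolve_right hu
    rw [hc0, zero_smul, add_zero] at hc
    exact hA.1 x hx (hc ▸ hw)
  have happ : ∀ (f : Module.Dual ℝ (Vec n)) (q : Tsub.dualCoannihilator),
      restrictToSub Tsub (Tsub.mkQ f) q = f q := fun f q => rfl
  have hbij : Function.Bijective (restrictToSub (M := Vec n) Tsub) := by
    constructor
    · rw [injective_iff_map_eq_zero]
      intro y hy
      obtain ⟨f, rfl⟩ := Tsub.mkQ_surjective y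
      have : f ∈ Tsub := hmemT f fun q hq => by
        rw [← happ f ⟨q, hq⟩, hy]
        rfl
      simpa using this
    · intro g
      obtain ⟨f, hf⟩ := LinearMap.exists_extend g
      exact ⟨Tsub.mkQ f, LinearMap.ext fun q => by rw [happ, ← hf]; rfl⟩
  refine ⟨hWQ, hdim, hthird, hbij, ?_⟩
  intro y z hyz
  rw [Projectivization.submodule_eq] at hyz
  obtain ⟨d, hd⟩ := Submodule.mem_span_singleton.mp hyz
  obtain ⟨f, hf⟩ := Tsub.mkQ_surjective y.rep
  have hd0 : d ≠ 0 := by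
    rintro rfl
    rw [zero_smul] at hd
    exact y.rep_nonzero (hbij.1 (by rw [← hd, map_zero]))
  have hzf : ∀ q : Tsub.dualCoannihilator, d * z.rep q = f q := by
    intro q
    rw [← happ, hf, ← hd]
    rfl
  rw [Set.mem_compl_iff, not_iff_comm]
  constructor
  · intro hz
    simp only [dualSet, Set.mem_setOf_eq, not_forall, not_not] at hz
    obtain ⟨x, hx, hinc⟩ := hz
    rw [Incident] at hinc
    have hfx : f x.rep = 0 := by rw [← hzf, hinc, mul_zero]
    obtain ⟨a, hadef⟩ : ∃ a, a = Projectivization.map Tsub.dualCoannihilator.subtype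
                (Submodule.injective_subtype _) x := ⟨_, rfl⟩
    rw [← hadef] at hx
    obtain ⟨e, he⟩ : ∃ e : ℝ, e • (x.rep : Vec n) = a.rep := by
      rw [← x.mk_rep, Projectivization.map_mk] at hadef
      obtain ⟨e, he⟩ := Projectivization.exists_smul_eq_mk_rep ℝ (x.rep : Vec n)
        (fun h => x.rep_nonzero (Subtype.ext h))
      exact ⟨e, by rw [hadef]; exact he⟩
    have haQ : a.rep ∈ Tsub.dualCoannihilator := he ▸ Submodule.smul_mem _ _ x.rep.2
    have hfa : f a.rep = 0 := by rw [← he, map_smul, hfx, smul_zero]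
    have haW := hA.1 a hx
    have hdec := mem_sup_of_finrank W _ hWQ hdim _ haQ haW
    obtain ⟨w, hw, hfw⟩ : ∃ w ∈ W, f w ≠ 0 := by
      by_contra! hcon
      have : f ∈ Tsub := hmemT f fun q hq => by
        obtain ⟨w, hw, c, rfl⟩ := hdec q hq
        rw [map_add, map_smul, hcon w hw, hfa, smul_zero, add_zero]
      exact y.rep_nonzero (by rw [← hf]; simpa using this)
    obtain ⟨H, hH, hHw, hHW, hHa, hmem⟩ := exists_hyper W A hA f w hw hfw a hx
    have hprop : ∀ q ∈ Tsub.dualCoannihilator, f w * H q = H w * f q := by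
      intro q hq
      obtain ⟨v, hv, c, rfl⟩ := hdec q hq
      have h1 := hHW (f w • v - f v • w) (W.sub_mem (W.smul_mem _ hv) (W.smul_mem _ hw)) (by
        simp [mul_comm])
      simp only [map_sub, map_smul, smul_eq_mul, map_add, hHa, hfa] at h1 ⊢
      linarith
    refine ⟨_, hmem, hthird _ hmem, ?_⟩
    obtain ⟨r, hr⟩ := Projectivization.exists_smul_eq_mk_rep ℝ H hH
    rw [Projectivization.submodule_eq, Submodule.mem_span_singleton]
    refine ⟨r * (H w / f w), hbij.1 (LinearMap.ext fun q => ?_)⟩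
    rw [← hf, ← hr, ← map_smul, happ, happ, Units.smul_def]
    simp only [LinearMap.smul_apply, smul_eq_mul]
    have := hprop q q.2
    field_simp
    linarith
  · rintro ⟨π, hπ, hπT, hπy⟩ hz
    rw [Projectivization.submodule_eq] at hπy
    obtain ⟨c, hc⟩ := Submodule.mem_span_singleton.mp hπy
    have hc0 : c ≠ 0 := by
      rintro rfl
      rw [zero_smul] at hc
      exact hπT (by simpa using hc.symm)
    obtain ⟨x, hx, hinc, hxQ⟩ := hπ _ hWQ hdim
    have hne : (⟨x.rep, hxQ⟩ : Tsub.dualCoannihilator) ≠ 0 := fun h =>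
      x.rep_nonzero (congrArg Subtype.val h)
    refine hz (Projectivization.mk ℝ ⟨x.rep, hxQ⟩ hne) ?_ ?_
    · rw [Set.mem_setOf_eq, Projectivization.map_mk]
      convert hx
      exact x.mk_rep
    · rw [Incident, rep_mk_zero_iff]
      have h1 : c * f x.rep = 0 := by
        have h2 := congrArg (fun g => restrictToSub Tsub g ⟨x.rep, hxQ⟩) hc
        simp only [← hf] at h2
        rw [← map_smul, happ, happ] at h2
        exact h2.trans hinc
      have h3 := hzf ⟨x.rep, hxQ⟩
      rw [(mul_eq_zero.mp h1).resolve_left hc0] at h3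
      exact (mul_eq_zero.mp h3).resolve_left hd0

end CC
end
end

section
/- Let L ⊆ ℝP^n be a projective subspace and A ⊆ ℝP^n a set with A ∩ L = ∅. Then A^⊥_L ∩ L* = ∅, so the L*-dual set (A^⊥_L)^⊥_{L*} ⊆ ℝP^n is defined (identifying ((ℝP^n)*)* with ℝP^n), and it is disjoint from L. Moreover, a point a ∈ ℝP^n ∖ L belongs to (A^⊥_L)^⊥_{L*} if and only if the following two conditions hold: (Condition 1) letting L_a denote the projective subspace spanned by L and a (dim L_a = dim L + 1), every hyperplane of L_a containing a intersects A ∩ L_a; (Condition 2) for every projective subspace L₁ ⊆ L with dim L₁ = dim L − 1, there exists a hyperplane of ℝP^n/L₁ that contains the image of a under the projection from center L₁ and is contained in the image of A under that projection. -/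
open Module Set Pointwise

noncomputable section

namespace CC

variable {M : Type*} [AddCommGroup M] [Module ℝ M]

section Helpers

theorem eq_sup_span_aux [FiniteDimensional ℝ M] {W N : Submodule ℝ M} (h : W ≤ N)
    (hf : finrank ℝ N = finrank ℝ W + 1) {v : M} (hv : v ∈ N) (hvW : v ∉ W) :
    W ⊔ Submodule.span ℝ {v} = N := by
  apply Submodule.eq_of_le_of_finrank_eq
  · exact sup_le h ((Submodule.span_singleton_le_iff_mem _ _).2 hv)
  · rw [Submodule.finrank_sup_span_singleton hvW, hf]

theorem exists_mem_aux {W N : Submodule ℝ M} [FiniteDimensional ℝ M]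
    (hf : finrank ℝ N = finrank ℝ W + 1) : ∃ v ∈ N, v ∉ W := by
  by_contra hc
  push Not at hc
  have : finrank ℝ N ≤ finrank ℝ W := Submodule.finrank_mono (fun v hv => hc v hv)
  omega

theorem disjoint_aux [FiniteDimensional ℝ M] (W : Submodule ℝ M)
    (A : Set (Projectivization ℝ M)) (hAL : ∀ x ∈ A, x.rep ∉ W)
    (π : Projectivization ℝ (Module.Dual ℝ M)) (hπ : π ∈ LdualSet W A) :
    π.rep ∉ W.dualAnnihilator := by
  intro hann
  rw [Submodule.mem_dualAnnihilator] at hann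
  obtain ⟨v, hv⟩ : ∃ v, π.rep v ≠ 0 := by
    by_contra hc
    push Not at hc
    exact π.rep_nonzero (LinearMap.ext hc)
  have hvW : v ∉ W := fun h => hv (hann v h)
  obtain ⟨x, hxA, hinc, hxN⟩ := hπ (W ⊔ Submodule.span ℝ {v}) le_sup_left
    (Submodule.finrank_sup_span_singleton hvW)
  obtain ⟨w, hw, z, hz, hx⟩ := Submodule.mem_sup.1 hxN
  obtain ⟨c, rfl⟩ := Submodule.mem_span_singleton.1 hz
  have h0 : π.rep x.rep = 0 := hinc
  rw [← hx, map_add, hann w hw, map_smul, zero_add, smul_eq_mul] at h0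
  have hc : c = 0 := (mul_eq_zero.1 h0).resolve_right hv
  apply hAL x hxA
  rw [← hx, hc]
  simpa using hw

theorem mem_of_ker_aux [FiniteDimensional ℝ M] {W W₁ : Submodule ℝ M} (h1 : W₁ ≤ W)
    (hf : finrank ℝ W₁ + 1 = finrank ℝ W) {φ : Module.Dual ℝ M}
    (hφ : φ ∈ W₁.dualAnnihilator) (hn : φ ∉ W.dualAnnihilator) {w : M} (hw : w ∈ W)
    (h0 : φ w = 0) : w ∈ W₁ := by
  by_contra hc
  apply hn
  rw [Submodule.mem_dualAnnihilator] at hφ ⊢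
  have := eq_sup_span_aux h1 hf.symm hw hc
  intro u hu
  rw [← this] at hu
  obtain ⟨p, hp, z, hz, rfl⟩ := Submodule.mem_sup.1 hu
  obtain ⟨c, rfl⟩ := Submodule.mem_span_singleton.1 hz
  simp [hφ p hp, h0]

theorem core_aux [FiniteDimensional ℝ M] (W W₁ : Submodule ℝ M)
    (A : Set (Projectivization ℝ M)) (hAL : ∀ x ∈ A, x.rep ∉ W) (h1 : W₁ ≤ W)
    (hf : finrank ℝ W₁ + 1 = finrank ℝ W)
    (π : Projectivization ℝ (Module.Dual ℝ M)) (hπ : π.rep ∈ W₁.dualAnnihilator) :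
    π ∈ LdualSet W A ↔
      ∀ v, v ∉ W₁ → π.rep v = 0 → ∃ x ∈ A, x.rep ∈ W₁ ⊔ Submodule.span ℝ {v} := by
  have hπ' := (Submodule.mem_dualAnnihilator _).1 hπ
  constructor
  · intro h v hv hv0
    have hn := disjoint_aux W A hAL π h
    have hvW : v ∉ W := fun hw => hv (mem_of_ker_aux h1 hf hπ hn hw hv0)
    obtain ⟨x, hxA, hinc, hxN⟩ := h (W ⊔ Submodule.span ℝ {v}) le_sup_left
      (Submodule.finrank_sup_span_singleton hvW)
    obtain ⟨w, hw, z, hz, hx⟩ := Submodule.mem_sup.1 hxN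
    obtain ⟨c, rfl⟩ := Submodule.mem_span_singleton.1 hz
    have h0 : π.rep x.rep = 0 := hinc
    rw [← hx, map_add, map_smul, hv0, smul_zero, add_zero] at h0
    refine ⟨x, hxA, ?_⟩
    rw [← hx]
    exact Submodule.add_mem_sup (mem_of_ker_aux h1 hf hπ hn hw h0) hz
  · intro h N hN hfN
    obtain ⟨w, hw, hw1⟩ := exists_mem_aux hf.symm
    have hw0 : π.rep w ≠ 0 := by
      intro h0
      obtain ⟨x, hxA, hx⟩ := h w hw1 h0
      rw [eq_sup_span_aux h1 hf.symm hw hw1] at hx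
      exact hAL x hxA hx
    obtain ⟨u, hu, huW⟩ := exists_mem_aux hfN
    set y := u - (π.rep u / π.rep w) • w with hy
    have hyW : y ∉ W := fun hc => huW (by
      have := W.add_mem hc (W.smul_mem (π.rep u / π.rep w) hw)
      simpa [hy] using this)
    have hyN : y ∈ N := N.sub_mem hu (N.smul_mem _ (hN hw))
    have hy0 : π.rep y = 0 := by
      simp [hy, hw0]
    obtain ⟨x, hxA, hx⟩ := h y (fun hc => hyW (h1 hc)) hy0
    refine ⟨x, hxA, ?_, ?_⟩
    · obtain ⟨p, hp, z, hz, hxe⟩ := Submodule.mem_sup.1 hx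
      obtain ⟨c, rfl⟩ := Submodule.mem_span_singleton.1 hz
      change π.rep x.rep = 0
      rw [← hxe]
      simp [hπ' p hp, hy0]
    · exact (sup_le (h1.trans hN) ((Submodule.span_singleton_le_iff_mem _ _).2 hyN)) hx

theorem toDD_rep [FiniteDimensional ℝ M] (a : Projectivization ℝ M) :
    ∃ c : ℝˣ, (toDoubleDual a).rep = c • Module.Dual.eval ℝ M a.rep := by
  have h : toDoubleDual a = Projectivization.mk ℝ (Module.evalEquiv ℝ M a.rep)
      ((Module.evalEquiv ℝ M).map_ne_zero_iff.2 a.rep_nonzero) := by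
    conv_lhs => rw [← a.mk_rep]
    exact Projectivization.map_mk _ _ _ _
  obtain ⟨c, hc⟩ := Projectivization.exists_smul_eq_mk_rep ℝ (Module.evalEquiv ℝ M a.rep)
      ((Module.evalEquiv ℝ M).map_ne_zero_iff.2 a.rep_nonzero)
  exact ⟨c, by rw [h, ← hc]; rfl⟩

theorem incident_toDD [FiniteDimensional ℝ M] (a : Projectivization ℝ M)
    (π : Projectivization ℝ (Module.Dual ℝ M)) :
    Incident (toDoubleDual a) π ↔ π.rep a.rep = 0 := by
  obtain ⟨c, hc⟩ := toDD_rep a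
  unfold Incident
  rw [hc, Units.smul_def]
  simp

theorem mem_sup_span_iff_mkQ (W₁ : Submodule ℝ M) (v x : M) :
    x ∈ W₁ ⊔ Submodule.span ℝ {v} ↔ W₁.mkQ x ∈ Submodule.span ℝ {W₁.mkQ v} := by
  rw [← Set.image_singleton, ← Submodule.map_span, ← Submodule.mem_comap,
    Submodule.comap_map_mkQ]

/-- Membership in the bidual, unpacked. -/
theorem mem_Lbidual_iff [FiniteDimensional ℝ M] (W : Submodule ℝ M)
    (A : Set (Projectivization ℝ M)) (hAL : ∀ x ∈ A, x.rep ∉ W) (a : Projectivization ℝ M) :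
    a ∈ Lbidual W A ↔ ∀ W₁ : Submodule ℝ M, W₁ ≤ W → finrank ℝ W₁ + 1 = finrank ℝ W →
      ∃ π : Projectivization ℝ (Module.Dual ℝ M), π.rep ∈ W₁.dualAnnihilator ∧
        π.rep a.rep = 0 ∧
        ∀ v, v ∉ W₁ → π.rep v = 0 → ∃ x ∈ A, x.rep ∈ W₁ ⊔ Submodule.span ℝ {v} := by
  constructor
  · intro h W₁ h1 hf
    have e1 := Subspace.finrank_add_finrank_dualAnnihilator_eq W₁
    have e2 := Subspace.finrank_add_finrank_dualAnnihilator_eq W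
    obtain ⟨π, hπ, hinc, hN⟩ := h W₁.dualAnnihilator (Submodule.dualAnnihilator_anti h1)
      (by omega)
    exact ⟨π, hN, (incident_toDD a π).1 hinc, (core_aux W W₁ A hAL h1 hf π hN).1 hπ⟩
  · intro h N hN hfN
    have e1 := Subspace.finrank_add_finrank_dualCoannihilator_eq N
    have e2 := Subspace.finrank_add_finrank_dualAnnihilator_eq W
    have hle : N.dualCoannihilator ≤ W := by
      have := Submodule.dualCoannihilator_anti hN
      rwa [Subspace.dualAnnihilator_dualCoannihilator_eq] at this
    have hf : finrank ℝ N.dualCoannihilator + 1 = finrank ℝ W := by omega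
    obtain ⟨π, hπ, ha, hv⟩ := h N.dualCoannihilator hle hf
    refine ⟨π, (core_aux W _ A hAL hle hf π hπ).2 hv, (incident_toDD a π).2 ha, ?_⟩
    rwa [Subspace.dualCoannihilator_dualAnnihilator_eq] at hπ

theorem cond2_iff [FiniteDimensional ℝ M] (W W₁ : Submodule ℝ M)
    (A : Set (Projectivization ℝ M)) (hAL : ∀ x ∈ A, x.rep ∉ W) (a : Projectivization ℝ M)
    (h1 : W₁ ≤ W) :
    (∃ π : Projectivization ℝ (Module.Dual ℝ M), π.rep ∈ W₁.dualAnnihilator ∧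
        π.rep a.rep = 0 ∧
        ∀ v, v ∉ W₁ → π.rep v = 0 → ∃ x ∈ A, x.rep ∈ W₁ ⊔ Submodule.span ℝ {v}) ↔
    ∃ ψ : Module.Dual ℝ (M ⧸ W₁), ψ ≠ 0 ∧ ψ (W₁.mkQ a.rep) = 0 ∧
              ∀ y : Projectivization ℝ (M ⧸ W₁), ψ y.rep = 0 →
                y ∈ projImage W₁ A := by
  constructor
  · rintro ⟨π, hπ, ha, hv⟩
    rw [Submodule.mem_dualAnnihilator] at hπ
    have hl : W₁ ≤ LinearMap.ker π.rep := fun v hv => LinearMap.mem_ker.2 (hπ v hv)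
    refine ⟨W₁.liftQ π.rep hl, ?_, ?_, ?_⟩
    · intro hz
      apply π.rep_nonzero
      have := Submodule.liftQ_mkQ W₁ π.rep hl
      rw [hz] at this
      simpa using this.symm
    · simpa using ha
    · intro y hy
      obtain ⟨v, hvy⟩ := W₁.mkQ_surjective y.rep
      have hv1 : v ∉ W₁ := by
        intro hc
        apply y.rep_nonzero
        rw [← hvy]
        simpa using hc
      obtain ⟨x, hxA, hx⟩ := hv v hv1 (by rw [← hvy] at hy; simpa using hy)
      refine ⟨x, hxA, fun hc => hAL x hxA (h1 hc), ?_⟩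
      rw [Projectivization.submodule_eq, ← hvy]
      exact (mem_sup_span_iff_mkQ _ _ _).1 hx
  · rintro ⟨ψ, hψ, ha, hy⟩
    have hne : ψ.comp W₁.mkQ ≠ 0 := by
      intro hz
      apply hψ
      ext v
      exact LinearMap.congr_fun hz v
    obtain ⟨c, hc⟩ := Projectivization.exists_smul_eq_mk_rep ℝ (ψ.comp W₁.mkQ) hne
    refine ⟨Projectivization.mk ℝ (ψ.comp W₁.mkQ) hne, ?_, ?_, ?_⟩
    · rw [← hc, Submodule.mem_dualAnnihilator]
      intro w hw
      have : W₁.mkQ w = 0 := by simpa using hw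
      rw [Units.smul_def, LinearMap.smul_apply, LinearMap.comp_apply, this]
      simp
    · rw [← hc, Units.smul_def, LinearMap.smul_apply, LinearMap.comp_apply, ha, smul_zero]
    · intro v hv hv0
      rw [← hc, Units.smul_def, LinearMap.smul_apply, LinearMap.comp_apply, smul_eq_mul] at hv0
      have hv0' : ψ (W₁.mkQ v) = 0 := (mul_eq_zero.1 hv0).resolve_left c.ne_zero
      have hvne : W₁.mkQ v ≠ 0 := by simpa using hv
      obtain ⟨d, hd⟩ := Projectivization.exists_smul_eq_mk_rep ℝ (W₁.mkQ v) hvne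
      obtain ⟨x, hxA, -, hx⟩ := hy (Projectivization.mk ℝ (W₁.mkQ v) hvne) (by
        rw [← hd, Units.smul_def, map_smul, hv0', smul_zero])
      rw [Projectivization.submodule_mk] at hx
      exact ⟨x, hxA, (mem_sup_span_iff_mkQ _ _ _).2 hx⟩

end Helpers

/-- For `A ⊆ ℝPⁿ` disjoint from `L = ℙ(W)`: `A^⊥_L` is disjoint from
`L*`, the set `(A^⊥_L)^⊥_{L*}` (viewed in `ℝPⁿ` via the identification `V ≅ V**`)
is disjoint from `L`, and a point `a ∉ L` lies in `(A^⊥_L)^⊥_{L*}` iff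
(Condition 1) every hyperplane of the span `L_a` of `L` and `a` containing `a` meets
`A ∩ L_a`, and (Condition 2) for every hyperplane `L₁` of `L`, some hyperplane of
`ℝPⁿ/L₁` contains the projection of `a` and is contained in the projection of `A`. -/
theorem statement7 (n : ℕ) (W : Submodule ℝ (Vec n)) (hW : W ≠ ⊥) (A : Set (Pt n))
    (hAL : ∀ x ∈ A, x.rep ∉ W) :
    (∀ π ∈ LdualSet W A, π.rep ∉ W.dualAnnihilator) ∧
    (∀ a ∈ Lbidual W A, a.rep ∉ W) ∧
    (∀ a : Pt n, a.rep ∉ W →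
      (a ∈ Lbidual W A ↔
        ((∀ P : Submodule ℝ (Vec n), P ≤ W ⊔ Submodule.span ℝ {a.rep} →
            finrank ℝ P + 1 = finrank ℝ ↥(W ⊔ Submodule.span ℝ {a.rep}) → a.rep ∈ P →
              ∃ x ∈ A, x.rep ∈ P) ∧
         (∀ W₁ : Submodule ℝ (Vec n), W₁ ≤ W → finrank ℝ W₁ + 1 = finrank ℝ W →
            ∃ ψ : Module.Dual ℝ (Vec n ⧸ W₁), ψ ≠ 0 ∧ ψ (W₁.mkQ a.rep) = 0 ∧
              ∀ y : Projectivization ℝ (Vec n ⧸ W₁), ψ y.rep = 0 →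
                y ∈ projImage W₁ A)))) := by
  refine ⟨disjoint_aux W A hAL, ?_, ?_⟩
  · intro a ha haW
    refine disjoint_aux W.dualAnnihilator (LdualSet W A) (disjoint_aux W A hAL) _ ha ?_
    rw [Submodule.mem_dualAnnihilator]
    intro φ hφ
    obtain ⟨c, hc⟩ := toDD_rep a
    rw [hc, Units.smul_def]
    simp [(Submodule.mem_dualAnnihilator _).1 hφ _ haW]
  · intro a haW
    rw [mem_Lbidual_iff W A hAL a]
    constructor
    · intro h
      refine ⟨?_, fun W₁ h1 hf => (cond2_iff W W₁ A hAL a h1).1 (h W₁ h1 hf)⟩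
      intro P hP hfP haP
      have hfW := Submodule.finrank_sup_span_singleton haW
      have hsup : W ⊔ P = W ⊔ Submodule.span ℝ {a.rep} :=
        le_antisymm (sup_le le_sup_left hP)
          (sup_le_sup_left ((Submodule.span_singleton_le_iff_mem _ _).2 haP) _)
      have hd := Submodule.finrank_sup_add_finrank_inf_eq W P
      rw [hsup] at hd
      obtain ⟨π, hπ, ha0, hv⟩ := h (W ⊓ P) inf_le_left (by omega)
      obtain ⟨x, hxA, hx⟩ := hv a.rep (fun hc => haW hc.1) ha0
      exact ⟨x, hxA,
        (sup_le inf_le_right ((Submodule.span_singleton_le_iff_mem _ _).2 haP)) hx⟩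
    · rintro ⟨-, h⟩ W₁ h1 hf
      exact (cond2_iff W W₁ A hAL a h1).2 (h W₁ h1 hf)

end CC
end
end

section
/- Let L ⊆ ℝP^n be a projective subspace and let A ⊆ ℝP^n be coseparable relative to L. Then for every projective subspace N with L ⊆ N and dim N = dim L + 1, the section (A^⊥_L)^⊥_{L*} ∩ N equals the double projective dual ((A ∩ N)*_p)*_p computed in the projective space N, i.e., the projective separability hull of A ∩ N in N. In particular, A ⊆ (A^⊥_L)^⊥_{L*}. -/
open Module Set Pointwise

noncomputable section

namespace CC

variable {M : Type*} [AddCommGroup M] [Module ℝ M]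

section Helpers

variable {V : Type*} [AddCommGroup V] [Module ℝ V] [FiniteDimensional ℝ V]

lemma aux_hyper (W W₁ : Submodule ℝ V) (h1 : W₁ ≤ W) (hr : finrank ℝ W₁ + 1 = finrank ℝ W)
    (f : Module.Dual ℝ V) (hf : ∀ w ∈ W₁, f w = 0) (u : V) (hu : u ∈ W) (hfu : f u ≠ 0)
    (w : V) (hw : w ∈ W) (hfw : f w = 0) : w ∈ W₁ := by
  have hle : W₁ ≤ W ⊓ LinearMap.ker f := le_inf h1 (fun z hz => hf z hz)
  have hlt : W ⊓ LinearMap.ker f < W :=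
    lt_of_le_of_ne inf_le_left (fun h => hfu (by
      have : u ∈ W ⊓ LinearMap.ker f := by rw [h]; exact hu
      exact this.2))
  have h2 := Submodule.finrank_lt_finrank_of_lt hlt
  have h3 : W₁ = W ⊓ LinearMap.ker f :=
    Submodule.eq_of_le_of_finrank_le hle (by omega)
  rw [h3]; exact ⟨hw, hfw⟩

lemma aux_hyper_rank (W : Submodule ℝ V) (f : Module.Dual ℝ V) (u : V) (hu : u ∈ W)
    (hfu : f u ≠ 0) : finrank ℝ (W ⊓ LinearMap.ker f : Submodule ℝ V) + 1 = finrank ℝ W := by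
  have hlt : W ⊓ LinearMap.ker f < W :=
    lt_of_le_of_ne inf_le_left (fun h => hfu (by
      have : u ∈ W ⊓ LinearMap.ker f := by rw [h]; exact hu
      exact this.2))
  have h2 := Submodule.finrank_lt_finrank_of_lt hlt
  have hf0 : f ≠ 0 := by rintro rfl; simp at hfu
  have h4 := Module.Dual.finrank_ker_add_one_of_ne_zero hf0
  have h5 := Submodule.finrank_sup_add_finrank_inf_eq W (LinearMap.ker f)
  have h6 := Submodule.finrank_le (W ⊔ LinearMap.ker f)
  omega

lemma aux_span (W N : Submodule ℝ V) (hWN : W ≤ N) (hr : finrank ℝ N = finrank ℝ W + 1)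
    (u : V) (hu : u ∈ N) (huW : u ∉ W) (a : V) (ha : a ∈ N) :
    ∃ c : ℝ, a - c • u ∈ W := by
  have hle : W ⊔ Submodule.span ℝ {u} ≤ N :=
    sup_le hWN ((Submodule.span_singleton_le_iff_mem _ _).2 hu)
  have hlt : W < W ⊔ Submodule.span ℝ {u} :=
    lt_of_le_of_ne le_sup_left (fun h => huW (by
      rw [h]; exact Submodule.mem_sup_right (Submodule.mem_span_singleton_self u)))
  have h2 := Submodule.finrank_lt_finrank_of_lt hlt
  have h3 := Submodule.eq_of_le_of_finrank_le hle (by omega)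
  rw [← h3] at ha
  obtain ⟨w, hw, z, hz, rfl⟩ := Submodule.mem_sup.1 ha
  obtain ⟨c, rfl⟩ := Submodule.mem_span_singleton.1 hz
  exact ⟨c, by simpa using hw⟩

lemma aux_rank (W : Submodule ℝ V) (u : V) (hu : u ∉ W) :
    finrank ℝ (W ⊔ Submodule.span ℝ {u} : Submodule ℝ V) = finrank ℝ W + 1 := by
  have hlt : W < W ⊔ Submodule.span ℝ {u} :=
    lt_of_le_of_ne le_sup_left (fun h => hu (by
      rw [h]; exact Submodule.mem_sup_right (Submodule.mem_span_singleton_self u)))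
  have h2 := Submodule.finrank_lt_finrank_of_lt hlt
  have h3 := Submodule.finrank_add_le_finrank_add_finrank W (Submodule.span ℝ {u})
  have h4 := finrank_span_singleton (K := ℝ) (v := u) (by rintro rfl; exact hu W.zero_mem)
  omega

lemma aux_functional (P : Submodule ℝ V) (u : V) (hu : u ∉ P) :
    ∃ f : Module.Dual ℝ V, f u ≠ 0 ∧ ∀ w ∈ P, f w = 0 := by
  obtain ⟨f, hf, hfp⟩ := Submodule.exists_dual_map_eq_bot_of_notMem hu inferInstance
  refine ⟨f, hf, fun w hw => ?_⟩
  have : f w ∈ P.map f := Submodule.mem_map_of_mem hw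
  rw [hfp] at this
  simpa using this

/-- The vector form of membership in the double dual. -/
def HullCond (W : Submodule ℝ V) (A : Set (Projectivization ℝ V)) (v : V) : Prop :=
  ∀ W₁ : Submodule ℝ V, W₁ ≤ W → finrank ℝ W₁ + 1 = finrank ℝ W →
    v ∈ W₁ ∨ ∃ a ∈ A, ∃ c : ℝ, a.rep - c • v ∈ W₁

lemma hullCond_iff (W : Submodule ℝ V) (A : Set (Projectivization ℝ V))
    (hAW : ∀ x ∈ A, x.rep ∉ W) (N : Submodule ℝ V) (hWN : W ≤ N)
    (hr : finrank ℝ N = finrank ℝ W + 1) (v : V) (hv : v ∈ N) (hv0 : v ≠ 0) :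
    HullCond W A v ↔ ∀ f : Module.Dual ℝ V, (∃ u ∈ N, f u ≠ 0) → f v = 0 →
      ∃ a ∈ A, a.rep ∈ N ∧ f a.rep = 0 := by
  constructor
  · intro h f ⟨u, huN, hfu⟩ hfv
    have hvW : v ∉ W := by
      intro hvW
      obtain ⟨g, hg, -⟩ := aux_functional (⊥ : Submodule ℝ V) v (by simpa using hv0)
      rcases h (W ⊓ LinearMap.ker g) inf_le_left (aux_hyper_rank W g v hvW hg) with h1 | h1
      · exact hg h1.2
      · obtain ⟨a, ha, c, hc⟩ := h1
        apply hAW a ha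
        have := W.add_mem hc.1 (W.smul_mem c hvW)
        simpa using this
    have : ∃ w ∈ W, f w ≠ 0 := by
      obtain ⟨c, hc⟩ := aux_span W N hWN hr v hv hvW u huN
      exact ⟨_, hc, by simpa [hfv] using hfu⟩
    obtain ⟨w, hw, hfw⟩ := this
    rcases h (W ⊓ LinearMap.ker f) inf_le_left (aux_hyper_rank W f w hw hfw) with h1 | h1
    · exact absurd h1.1 hvW
    · obtain ⟨a, ha, c, hc⟩ := h1
      refine ⟨a, ha, ?_, ?_⟩
      · have := N.add_mem (hWN hc.1) (N.smul_mem c hv)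
        simpa using this
      · have : f (a.rep - c • v) = 0 := hc.2
        simpa [hfv] using this
  · intro h W₁ h1 hr1
    by_cases hv1 : v ∈ W₁
    · exact Or.inl hv1
    right
    have hvW : v ∉ W := by
      intro hvW
      have hlt : W < N := lt_of_le_of_ne hWN (by rintro rfl; omega)
      obtain ⟨u, huN, huW⟩ := SetLike.exists_of_lt hlt
      obtain ⟨f, hf, hfW⟩ := aux_functional W u huW
      obtain ⟨a, ha, haN, hfa⟩ := h f ⟨u, huN, hf⟩ (hfW v hvW)
      obtain ⟨c, hc⟩ := aux_span W N hWN hr u huN huW _ haN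
      have h2 := hfW _ hc
      have h3 : c = 0 := by simpa [hfa, hf] using h2
      subst h3
      exact hAW a ha (by simpa using hc)
    have hlt : W₁ ⊔ Submodule.span ℝ {v} < N := by
      refine lt_of_le_of_ne (sup_le (h1.trans hWN)
        ((Submodule.span_singleton_le_iff_mem _ _).2 hv)) ?_
      intro h2
      have := aux_rank W₁ v hv1
      rw [h2] at this
      omega
    obtain ⟨u, huN, huW⟩ := SetLike.exists_of_lt hlt
    obtain ⟨f, hf, hfW⟩ := aux_functional _ u huW
    have hfv := hfW v (Submodule.mem_sup_right (Submodule.mem_span_singleton_self v))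
    obtain ⟨a, ha, haN, hfa⟩ := h f ⟨u, huN, hf⟩ hfv
    obtain ⟨c, hc⟩ := aux_span W N hWN hr v hv hvW _ haN
    obtain ⟨d, hd⟩ := aux_span W N hWN hr v hv hvW _ huN
    exact ⟨a, ha, c, aux_hyper W W₁ h1 hr1 f (fun w hw => hfW w (Submodule.mem_sup_left hw))
      _ hd (by simpa [hfv] using hf) _ hc (by simp [hfa, hfv])⟩

lemma incident_mk (f : Module.Dual ℝ V) (hf : f ≠ 0) (x : Projectivization ℝ V) :
    Incident (Projectivization.mk ℝ f hf) x ↔ f x.rep = 0 := by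
  obtain ⟨c, hc⟩ := Projectivization.exists_smul_eq_mk_rep ℝ f hf
  unfold Incident
  rw [← hc]
  simp [Units.smul_def]

lemma incident_dd (x : Projectivization ℝ V) (π : Projectivization ℝ (Module.Dual ℝ V)) :
    Incident (toDoubleDual x) π ↔ π.rep x.rep = 0 := by
  have : toDoubleDual x = Projectivization.mk ℝ (Module.evalEquiv ℝ V x.rep)
      ((LinearEquiv.map_ne_zero_iff _).2 x.rep_nonzero) := by
    conv_lhs => rw [← x.mk_rep]
    rfl
  rw [this, incident_mk]
  simp

lemma bidual_iff (W : Submodule ℝ V) (A : Set (Projectivization ℝ V))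
    (hA : Coseparable W A) (x : Projectivization ℝ V) :
    x ∈ Lbidual W A ↔ HullCond W A x.rep := by
  constructor
  · intro h W₁ h1 hr1
    by_cases hx1 : x.rep ∈ W₁
    · exact Or.inl hx1
    right
    have e1 := Subspace.finrank_add_finrank_dualAnnihilator_eq W
    have e2 := Subspace.finrank_add_finrank_dualAnnihilator_eq W₁
    obtain ⟨π, hπ, hi, hπ1⟩ := h W₁.dualAnnihilator (Submodule.dualAnnihilator_anti h1) (by omega)
    rw [incident_dd] at hi
    rw [Submodule.mem_dualAnnihilator] at hπ1
    have hW : ∃ u ∈ W, π.rep u ≠ 0 := by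
      by_contra! hcon
      obtain ⟨v, hv⟩ : ∃ v, π.rep v ≠ 0 := by
        by_contra! h0
        exact π.rep_nonzero (LinearMap.ext h0)
      have hvW : v ∉ W := fun hvW => hv (hcon v hvW)
      obtain ⟨a, ha, hai, haN⟩ := hπ (W ⊔ Submodule.span ℝ {v}) le_sup_left (aux_rank W v hvW)
      obtain ⟨c, hc⟩ := aux_span W _ le_sup_left (aux_rank W v hvW) v
        (Submodule.mem_sup_right (Submodule.mem_span_singleton_self v)) hvW _ haN
      have h2 := hcon _ hc
      have hai : π.rep a.rep = 0 := hai
      have h3 : c = 0 := by simpa [hai, hv] using h2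
      subst h3
      exact hA.1 a ha (by simpa using hc)
    obtain ⟨u, hu, hπu⟩ := hW
    by_cases hxW : x.rep ∈ W
    · exact absurd (aux_hyper W W₁ h1 hr1 π.rep hπ1 u hu hπu _ hxW hi) hx1
    · obtain ⟨a, ha, hai, haN⟩ := hπ _ le_sup_left (aux_rank W _ hxW)
      obtain ⟨c, hc⟩ := aux_span W _ le_sup_left (aux_rank W _ hxW) x.rep
        (Submodule.mem_sup_right (Submodule.mem_span_singleton_self _)) hxW _ haN
      have hai : π.rep a.rep = 0 := hai
      exact ⟨a, ha, c, aux_hyper W W₁ h1 hr1 π.rep hπ1 u hu hπu _ hc (by simp [hai, hi])⟩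
  · intro h T hT hTr
    have hTW : T.dualCoannihilator.dualAnnihilator = T :=
      Subspace.dualCoannihilator_dualAnnihilator_eq
    obtain ⟨W₁, hW₁⟩ : ∃ W₁ : Submodule ℝ V, W₁ = T.dualCoannihilator := ⟨_, rfl⟩
    rw [← hW₁] at hTW
    have h1 : W₁ ≤ W := by
      have := Submodule.dualCoannihilator_anti hT
      rwa [Subspace.dualAnnihilator_dualCoannihilator_eq, ← hW₁] at this
    have hr1 : finrank ℝ W₁ + 1 = finrank ℝ W := by
      have e1 := Subspace.finrank_add_finrank_dualAnnihilator_eq W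
      have e2 := Subspace.finrank_add_finrank_dualAnnihilator_eq W₁
      rw [hTW] at e2
      omega
    obtain ⟨φ, hφ0, hφB, hsep⟩ := hA.2 W₁ h1 hr1
    have key : ∃ g : Module.Dual ℝ (V ⧸ W₁), g ≠ 0 ∧ g (W₁.mkQ x.rep) = 0 ∧
        ∀ y ∈ (projImage W₁ A)ᶜ, g y.rep ≠ 0 := by
      by_cases hx1 : x.rep ∈ W₁
      · refine ⟨φ, hφ0, ?_, hφB⟩
        rw [(Submodule.Quotient.mk_eq_zero W₁).2 hx1 |> fun h => (show W₁.mkQ x.rep = 0 from h)]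
        simp
      obtain ⟨a, ha, c, hc⟩ := (h W₁ h1 hr1).resolve_left hx1
      have hx0 : W₁.mkQ x.rep ≠ 0 := by
        intro h0
        exact hx1 ((Submodule.Quotient.mk_eq_zero W₁).1 h0)
      obtain ⟨d, hd⟩ := Projectivization.exists_smul_eq_mk_rep ℝ _ hx0
      have hyB : Projectivization.mk ℝ _ hx0 ∉ (projImage W₁ A)ᶜ := by
        intro hn
        apply hn
        refine ⟨a, ha, fun h' => hA.1 a ha (h1 h'), ?_⟩
        rw [Projectivization.submodule_mk, Submodule.mem_span_singleton]
        refine ⟨c, ?_⟩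
        have : W₁.mkQ (a.rep - c • x.rep) = 0 := (Submodule.Quotient.mk_eq_zero W₁).2 hc
        rw [map_sub, map_smul, sub_eq_zero] at this
        exact this.symm
      have tr : ∀ g : Module.Dual ℝ (V ⧸ W₁), g (Projectivization.mk ℝ _ hx0).rep = 0 →
          g (W₁.mkQ x.rep) = 0 := by
        intro g hg
        rw [← hd, Units.smul_def, map_smul, smul_eq_mul] at hg
        exact (mul_eq_zero.1 hg).resolve_left d.ne_zero
      by_cases hφy : φ (Projectivization.mk ℝ _ hx0).rep = 0
      · exact ⟨φ, hφ0, tr φ hφy, hφB⟩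
      obtain ⟨g, hg, hgy, hgB⟩ := hsep _ hφy hyB
      refine ⟨g - (g (Projectivization.mk ℝ _ hx0).rep / φ (Projectivization.mk ℝ _ hx0).rep) • φ,
        sub_ne_zero.2 (hg _), tr _ ?_, ?_⟩
      · rw [LinearMap.sub_apply, LinearMap.smul_apply, smul_eq_mul, div_mul_cancel₀ _ hφy, sub_self]
      · intro z hz h0
        have h2 := hgB z hz
        have h3 := hφB z hz
        simp only [LinearMap.sub_apply, LinearMap.smul_apply, smul_eq_mul, sub_eq_zero] at h0
        rw [h0, mul_div_cancel_right₀ _ h3] at h2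
        linarith
    obtain ⟨g, hg0, hgx, hgB⟩ := key
    have hf0 : g ∘ₗ W₁.mkQ ≠ 0 := by
      intro h0
      apply hg0
      ext v
      exact LinearMap.congr_fun h0 v
    refine ⟨Projectivization.mk ℝ (g ∘ₗ W₁.mkQ) hf0, ?_, ?_, ?_⟩
    · intro N hWN hNr
      have : ∃ v ∈ N, (g ∘ₗ W₁.mkQ) v = 0 ∧ v ∉ W₁ := by
        by_contra! hcon
        have hle : N ⊓ LinearMap.ker (g ∘ₗ W₁.mkQ) ≤ W₁ := fun v hv => hcon v hv.1 hv.2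
        have e1 := Submodule.finrank_mono hle
        have e4 := Module.Dual.finrank_ker_add_one_of_ne_zero hf0
        have e5 := Submodule.finrank_sup_add_finrank_inf_eq N (LinearMap.ker (g ∘ₗ W₁.mkQ))
        have e6 := Submodule.finrank_le (N ⊔ LinearMap.ker (g ∘ₗ W₁.mkQ))
        omega
      obtain ⟨v, hvN, hgv, hv1⟩ := this
      have hv0 : W₁.mkQ v ≠ 0 := fun h0 => hv1 ((Submodule.Quotient.mk_eq_zero W₁).1 h0)
      obtain ⟨d, hd⟩ := Projectivization.exists_smul_eq_mk_rep ℝ _ hv0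
      have hmem : Projectivization.mk ℝ _ hv0 ∈ projImage W₁ A := by
        by_contra hn
        apply hgB _ hn
        rw [← hd, Units.smul_def, map_smul]
        have : g (W₁.mkQ v) = 0 := hgv
        rw [this, smul_zero]
      obtain ⟨a, ha, -, hav⟩ := hmem
      rw [Projectivization.submodule_mk, Submodule.mem_span_singleton] at hav
      obtain ⟨c, hc⟩ := hav
      refine ⟨a, ha, ?_, ?_⟩
      · rw [incident_mk, LinearMap.comp_apply, ← hc, map_smul]
        have : g (W₁.mkQ v) = 0 := hgv
        rw [this, smul_zero]
      · rw [← map_smul] at hc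
        have h5 : c • v - a.rep ∈ W₁ := (Submodule.Quotient.eq W₁).1 hc
        have := N.sub_mem (N.smul_mem c hvN) (hWN (h1 h5))
        simpa using this
    · rw [incident_dd]
      obtain ⟨d, hd⟩ := Projectivization.exists_smul_eq_mk_rep ℝ _ hf0
      rw [← hd, Units.smul_def, LinearMap.smul_apply, LinearMap.comp_apply, hgx, smul_zero]
    · obtain ⟨d, hd⟩ := Projectivization.exists_smul_eq_mk_rep ℝ _ hf0
      rw [← hd, Units.smul_def]
      apply T.smul_mem
      rw [← hTW, Submodule.mem_dualAnnihilator]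
      intro w hw
      have : W₁.mkQ w = 0 := (Submodule.Quotient.mk_eq_zero W₁).2 hw
      rw [LinearMap.comp_apply, this, map_zero]

lemma map_rep (N : Submodule ℝ V) (y : Projectivization ℝ N) :
    ∃ c : ℝ, c ≠ 0 ∧ (Projectivization.map N.subtype (Submodule.injective_subtype N) y).rep
      = c • (y.rep : V) := by
  have hy0 : N.subtype y.rep ≠ 0 := by simpa using y.rep_nonzero
  have : Projectivization.map N.subtype (Submodule.injective_subtype N) y
      = Projectivization.mk ℝ (N.subtype y.rep) hy0 := by
    conv_lhs => rw [← y.mk_rep]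
    rfl
  obtain ⟨d, hd⟩ := Projectivization.exists_smul_eq_mk_rep ℝ _ hy0
  rw [this, ← hd]
  exact ⟨d, d.ne_zero, rfl⟩

lemma exists_map_eq (N : Submodule ℝ V) (x : Projectivization ℝ V) (hx : x.rep ∈ N) :
    ∃ y : Projectivization ℝ N,
      Projectivization.map N.subtype (Submodule.injective_subtype N) y = x := by
  refine ⟨Projectivization.mk ℝ ⟨x.rep, hx⟩ (fun h => x.rep_nonzero (congrArg Subtype.val h)), ?_⟩
  rw [Projectivization.map_mk]
  exact x.mk_rep

lemma hull_iff (N : Submodule ℝ V) (A : Set (Projectivization ℝ V)) (y : Projectivization ℝ N) :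
    toDoubleDual y ∈ dualSet (dualSet
      (Projectivization.map N.subtype (Submodule.injective_subtype N) ⁻¹' A)) ↔
    ∀ f : Module.Dual ℝ V, (∃ u ∈ N, f u ≠ 0) →
      f (Projectivization.map N.subtype (Submodule.injective_subtype N) y).rep = 0 →
      ∃ a ∈ A, a.rep ∈ N ∧ f a.rep = 0 := by
  obtain ⟨c, hc0, hc⟩ := map_rep N y
  rw [hc]
  constructor
  · rintro h f ⟨u, huN, hfu⟩ hfy
    have hg0 : f ∘ₗ N.subtype ≠ 0 := fun h0 => hfu (LinearMap.congr_fun h0 ⟨u, huN⟩)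
    have hfy' : f (y.rep : V) = 0 := by simpa [hc0] using hfy
    by_contra! hcon
    apply h (Projectivization.mk ℝ _ hg0)
    · intro z hz hi
      rw [incident_mk] at hi
      obtain ⟨d, hd0, hd⟩ := map_rep N z
      apply hcon _ hz
      · rw [hd]; exact N.smul_mem _ z.rep.2
      · rw [hd, map_smul]
        have : f (z.rep : V) = 0 := hi
        rw [this, smul_zero]
    · rw [incident_dd]
      obtain ⟨d, hd⟩ := Projectivization.exists_smul_eq_mk_rep ℝ _ hg0
      rw [← hd, Units.smul_def, LinearMap.smul_apply, LinearMap.comp_apply]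
      simp [hfy']
  · intro h π hπ hi
    rw [incident_dd] at hi
    obtain ⟨f, hf⟩ := LinearMap.exists_extend π.rep
    have hfv : ∀ z : N, f z = π.rep z := fun z => LinearMap.congr_fun hf z
    obtain ⟨u, hu⟩ : ∃ u, π.rep u ≠ 0 := by
      by_contra! h0
      exact π.rep_nonzero (LinearMap.ext h0)
    obtain ⟨a, ha, haN, hfa⟩ := h f ⟨u, u.2, by rwa [hfv]⟩ (by rw [map_smul, hfv, hi, smul_zero])
    obtain ⟨z, rfl⟩ := exists_map_eq N a haN
    refine hπ z ha ?_
    obtain ⟨d, hd0, hd⟩ := map_rep N z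
    rw [hd, map_smul, hfv] at hfa
    exact (smul_eq_zero.1 hfa).resolve_left hd0

end Helpers

/-- If `A ⊆ ℝPⁿ` is coseparable relative to `L = ℙ(W)`, then for every
projective subspace `N ⊇ L` with `dim N = dim L + 1` the section
`(A^⊥_L)^⊥_{L*} ∩ N` equals the double projective dual `((A ∩ N)*_p)*_p` computed in
the projective space `N` (the projective separability hull of `A ∩ N` in `N`).
In particular `A ⊆ (A^⊥_L)^⊥_{L*}`. -/
theorem statement9 (n : ℕ) (W : Submodule ℝ (Vec n)) (hW : W ≠ ⊥) (A : Set (Pt n))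
    (hA : Coseparable W A) :
    (∀ N : Submodule ℝ (Vec n), W ≤ N → finrank ℝ N = finrank ℝ W + 1 →
      Lbidual W A ∩ projSet N =
        Projectivization.map N.subtype (Submodule.injective_subtype N) ''
          (toDoubleDual ⁻¹' dualSet (dualSet
            (Projectivization.map N.subtype (Submodule.injective_subtype N) ⁻¹' A)))) ∧
    A ⊆ Lbidual W A := by
  refine ⟨?_, ?_⟩
  · intro N hWN hr
    ext x
    constructor
    · rintro ⟨hx, hxN⟩
      obtain ⟨y, rfl⟩ := exists_map_eq N x hxN
      refine ⟨y, ?_, rfl⟩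
      rw [bidual_iff W A hA,
        hullCond_iff W A hA.1 N hWN hr _ hxN (Projectivization.rep_nonzero _)] at hx
      exact (hull_iff N A y).2 hx
    · rintro ⟨y, hy, rfl⟩
      have hxN : (Projectivization.map N.subtype (Submodule.injective_subtype N) y).rep ∈ N := by
        obtain ⟨c, -, hc⟩ := map_rep N y
        rw [hc]
        exact N.smul_mem _ y.rep.2
      refine ⟨?_, hxN⟩
      rw [bidual_iff W A hA,
        hullCond_iff W A hA.1 N hWN hr _ hxN (Projectivization.rep_nonzero _)]
      exact (hull_iff N A y).1 hy
  · intro x hx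
    rw [bidual_iff W A hA]
    intro W₁ _ _
    exact Or.inr ⟨x, hx, 1, by simp⟩

end CC
end
end
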